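/- Let b ≥ 2 and α ≠ β digits. Let K₁ be the sum of 1/n over positive integers n with exactly one occurrence of αβ in base b. Then K₁ = Σ_{b ≤ n̄ < b², n̄ ≠ αb+β} V(n̄) − Σ_{n₁=1}^{b-1} V(n₁b²+αb+β) + δ_{α≠0}·U(αb+β) + Σ_{n₁=1}^{b-1} U(n₁b²+αb+β), where U and V are the reciprocal subsums defined by the leading-digit condition with trailing part avoiding αβ, resp. containing exactly one αβ. -/

import Mathlib

/-- The base-`b` digits of `n`, leading digit first. -/
def digitsBE (b n : ℕ) : List ℕ := (Nat.digits b n).reverse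

/-- `m`'s leading digits form `n` and the trailing digit string avoids `αβ`. -/
def KeptU (b α β n m : ℕ) : Prop :=
  ∃ t : List ℕ, digitsBE b m = digitsBE b n ++ t ∧ ¬ [α, β] <:+: t

/-- `m`'s leading digits form `n` and the trailing digit string contains exactly one
contiguous occurrence of `αβ`. -/
def KeptV (b α β n m : ℕ) : Prop :=
  ∃ t : List ℕ, digitsBE b m = digitsBE b n ++ t ∧ (t.zip t.tail).count (α, β) = 1

noncomputable def U (b α β n : ℕ) : ℝ :=
  ∑' m : {m : ℕ // KeptU b α β n m}, (1 : ℝ) / (m : ℕ)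

noncomputable def V (b α β n : ℕ) : ℝ :=
  ∑' m : {m : ℕ // KeptV b α β n m}, (1 : ℝ) / (m : ℕ)

/-- The sum of `1/m` over positive integers `m` whose base-`b` representation has
exactly one contiguous occurrence of `αβ`. -/
noncomputable def K1 (b α β : ℕ) : ℝ :=
  ∑' m : {m : ℕ // 0 < m ∧
      ((digitsBE b m).zip (digitsBE b m).tail).count (α, β) = 1}, (1 : ℝ) / (m : ℕ)

/-- number of contiguous occurrences of the pair -/
def pairCnt (α β : ℕ) (l : List ℕ) : ℕ := (l.zip l.tail).count (α, β)

lemma pairCnt_nil (α β : ℕ) : pairCnt α β [] = 0 := by simp [pairCnt]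

lemma pairCnt_single (α β x : ℕ) : pairCnt α β [x] = 0 := by simp [pairCnt]

lemma pairCnt_cons_cons (α β x y : ℕ) (l : List ℕ) :
    pairCnt α β (x :: y :: l) = pairCnt α β (y :: l) + if x = α ∧ y = β then 1 else 0 := by
  simp [pairCnt, List.count_cons]

lemma pairCnt_le_cons (α β x : ℕ) (l : List ℕ) :
    pairCnt α β l ≤ pairCnt α β (x :: l) := by
  cases l with
  | nil => simp [pairCnt_nil]
  | cons y l => rw [pairCnt_cons_cons]; omega

lemma pairCnt_cons_le (α β x : ℕ) (l : List ℕ) :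
    pairCnt α β (x :: l) ≤ pairCnt α β l + 1 := by
  cases l with
  | nil => simp [pairCnt_single]
  | cons y l => rw [pairCnt_cons_cons]; split_ifs <;> omega

lemma pairCnt_append_le (α β : ℕ) (l t : List ℕ) :
    pairCnt α β (l ++ t) ≤ l.length + pairCnt α β t := by
  induction l with
  | nil => simp
  | cons x l ih =>
    have := pairCnt_cons_le α β x (l ++ t)
    simp only [List.cons_append, List.length_cons]
    omega

lemma pairCnt_append_ge (α β : ℕ) (l t : List ℕ) :
    pairCnt α β l + pairCnt α β t ≤ pairCnt α β (l ++ t) := by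
  induction l with
  | nil => simp [pairCnt_nil]
  | cons x l ih =>
    cases l with
    | nil =>
      have := pairCnt_le_cons α β x t
      simpa [pairCnt_single] using this
    | cons y l =>
      simp only [List.cons_append] at ih ⊢
      rw [pairCnt_cons_cons, pairCnt_cons_cons]
      omega

lemma infix_iff_pairCnt (α β : ℕ) (t : List ℕ) :
    ¬ [α, β] <:+: t ↔ pairCnt α β t = 0 := by
  induction t with
  | nil => simp [pairCnt_nil]
  | cons x l ih =>
    rw [List.infix_cons_iff, not_or, ih]
    cases l with
    | nil => simp [pairCnt_nil, pairCnt_single, List.cons_prefix_cons]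
    | cons y l =>
      rw [pairCnt_cons_cons]
      simp only [List.cons_prefix_cons, List.nil_prefix, and_true]
      by_cases h : x = α ∧ y = β
      · obtain ⟨rfl, rfl⟩ := h
        simp
      · have h2 : ¬ (α = x ∧ β = y) := fun h' => h ⟨h'.1.symm, h'.2.symm⟩
        simp [h, h2]

lemma digitsBE_step (b : ℕ) (hb : 2 ≤ b) (q r : ℕ) (hr : r < b) (h : 0 < q ∨ 0 < r) :
    digitsBE b (b * q + r) = digitsBE b q ++ [r] := by
  unfold digitsBE
  rw [add_comm, Nat.digits_add b (by omega) r q hr (by omega)]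
  simp

lemma digitsBE_zero (b : ℕ) : digitsBE b 0 = [] := by simp [digitsBE]

lemma digitsBE_one (b : ℕ) (hb : 2 ≤ b) (r : ℕ) (hr : r < b) (h : 0 < r) :
    digitsBE b r = [r] := by
  have := digitsBE_step b hb 0 r hr (Or.inr h)
  simpa [digitsBE_zero] using this

lemma digitsBE_two (b : ℕ) (hb : 2 ≤ b) (x y : ℕ) (hx : x < b) (hy : y < b) (h : 0 < x) :
    digitsBE b (x * b + y) = [x, y] := by
  have := digitsBE_step b hb x y hy (Or.inl h)
  rw [digitsBE_one b hb x hx h, mul_comm] at this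
  simpa using this

lemma digitsBE_three (b : ℕ) (hb : 2 ≤ b) (w x y : ℕ) (hw : w < b) (hx : x < b) (hy : y < b)
    (h : 0 < w) : digitsBE b (w * b ^ 2 + x * b + y) = [w, x, y] := by
  have := digitsBE_step b hb (w * b + x) y hy (Or.inl (by positivity))
  rw [digitsBE_two b hb w x hw hx h] at this
  rw [show w * b ^ 2 + x * b + y = b * (w * b + x) + y by ring, this]
  rfl

/-- weight -/
noncomputable def wt (b α β m : ℕ) : ℝ := (1 / 2) ^ (pairCnt α β (digitsBE b m)) * (1 / (m : ℝ))

lemma wt_nonneg (b α β m : ℕ) : 0 ≤ wt b α β m := by unfold wt; positivity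

lemma wt_le_one (b α β m : ℕ) : wt b α β m ≤ 1 := by
  unfold wt
  have h1 : ((1:ℝ) / 2) ^ (pairCnt α β (digitsBE b m)) ≤ 1 :=
    pow_le_one₀ (by norm_num) (by norm_num)
  have h2 : (1:ℝ) / m ≤ 1 := by
    rcases Nat.eq_zero_or_pos m with rfl | h
    · simp
    · rw [div_le_one (by positivity)]; exact_mod_cast h
  have h3 : (0:ℝ) ≤ 1 / m := by positivity
  exact mul_le_one₀ h1 h3 h2

lemma wt_step (b : ℕ) (hb : 2 ≤ b) (α β : ℕ) (hβ : β < b) (q r : ℕ) (hr : r < b ^ 2) (hq : 0 < q) :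
    wt b α β (b ^ 2 * q + r) ≤
      wt b α β q * (1 / (b : ℝ) ^ 2) * (if r = α * b + β then 1 / 2 else 1) := by
  have hx : r / b < b := Nat.div_lt_of_lt_mul (by rw [← pow_two]; exact hr)
  have hy : r % b < b := Nat.mod_lt _ (by omega)
  have hD : digitsBE b (b ^ 2 * q + r) = digitsBE b q ++ [r / b, r % b] := by
    have h1 := digitsBE_step b hb (b * q + r / b) (r % b) hy (Or.inl (by positivity))
    rw [digitsBE_step b hb q (r / b) hx (Or.inl hq)] at h1
    rw [show b ^ 2 * q + r = b * (b * q + r / b) + r % b by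
      rw [mul_add, add_assoc, Nat.div_add_mod]; ring, h1]
    simp
  have hge := pairCnt_append_ge α β (digitsBE b q) [r / b, r % b]
  rw [← hD, pairCnt_cons_cons, pairCnt_single] at hge
  have hinv : (1:ℝ) / ((b ^ 2 * q + r : ℕ) : ℝ) ≤ (1 / (q:ℝ)) * (1 / (b : ℝ) ^ 2) := by
    rw [one_div_mul_one_div]
    apply one_div_le_one_div_of_le (by positivity)
    push_cast
    nlinarith [(Nat.cast_nonneg r : (0:ℝ) ≤ r)]
  have hpow : ((1:ℝ) / 2) ^ (pairCnt α β (digitsBE b (b ^ 2 * q + r))) ≤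
      (1 / 2) ^ (pairCnt α β (digitsBE b q)) * (if r = α * b + β then 1 / 2 else 1) := by
    split_ifs with h
    · have h1 : r / b = α := by
        rw [h, mul_comm, Nat.mul_add_div (by omega), Nat.div_eq_of_lt hβ]; simp
      have h2 : r % b = β := by
        rw [h, mul_comm, Nat.mul_add_mod, Nat.mod_eq_of_lt hβ]
      rw [if_pos ⟨h1, h2⟩] at hge
      rw [← pow_succ]
      exact pow_le_pow_of_le_one (by norm_num) (by norm_num) (by omega)
    · rw [mul_one]
      exact pow_le_pow_of_le_one (by norm_num) (by norm_num) (by omega)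
  unfold wt
  calc _ ≤ ((1 / 2) ^ (pairCnt α β (digitsBE b q)) * (if r = α * b + β then 1 / 2 else 1)) *
        ((1 / (q:ℝ)) * (1 / (b : ℝ) ^ 2)) := by
        apply mul_le_mul hpow hinv (by positivity)
        split_ifs <;> positivity
    _ = _ := by ring

lemma sum_range_mul_aux (B : ℕ) (f : ℕ → ℝ) (M : ℕ) :
    ∑ m ∈ Finset.range (B * M), f m =
      ∑ q ∈ Finset.range M, ∑ r ∈ Finset.range B, f (B * q + r) := by
  induction M with
  | zero => simp
  | succ M ih => rw [Nat.mul_succ, Finset.sum_range_add, ih, Finset.sum_range_succ]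

lemma wt_sum_le (b : ℕ) (hb : 2 ≤ b) (α β : ℕ) (hα : α < b) (hβ : β < b) (N : ℕ) :
    ∑ m ∈ Finset.range ((b ^ 2) ^ N), wt b α β m ≤ 2 * (b : ℝ) ^ 4 := by
  have hbR : (2:ℝ) ≤ b := by exact_mod_cast hb
  induction N with
  | zero =>
    simp [wt]
  | succ N ih =>
    have hd : α * b + β < b ^ 2 := by nlinarith
    rw [pow_succ', sum_range_mul_aux]
    have hpos : 0 < (b ^ 2) ^ N := by positivity
    have hinner : ∀ q, 0 < q → ∑ r ∈ Finset.range (b ^ 2), wt b α β (b ^ 2 * q + r) ≤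
        wt b α β q * (1 - 1 / (2 * (b:ℝ) ^ 2)) := by
      intro q hq
      calc _ ≤ ∑ r ∈ Finset.range (b ^ 2), wt b α β q * (1 / (b : ℝ) ^ 2) *
              (if r = α * b + β then 1 / 2 else 1) :=
            Finset.sum_le_sum fun r hr => wt_step b hb α β hβ q r (Finset.mem_range.1 hr) hq
        _ = _ := by
          rw [← Finset.mul_sum]
          have : ∀ r : ℕ, (if r = α * b + β then (1:ℝ) / 2 else 1) =
              1 - if r = α * b + β then 1 / 2 else 0 := by
            intro r; split_ifs <;> norm_num
          simp_rw [this]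
          rw [Finset.sum_sub_distrib, Finset.sum_ite_eq', if_pos (Finset.mem_range.2 hd)]
          simp only [Finset.sum_const, Finset.card_range, nsmul_eq_mul]
          push_cast
          field_simp
    have h0 : wt b α β 0 = 0 := by simp [wt]
    have hq0 : ∑ r ∈ Finset.range (b ^ 2), wt b α β (b ^ 2 * 0 + r) ≤ (b:ℝ) ^ 2 := by
      calc _ ≤ ∑ r ∈ Finset.range (b ^ 2), (1:ℝ) :=
            Finset.sum_le_sum fun r _ => wt_le_one b α β _
        _ = _ := by simp
    obtain ⟨M, hM⟩ := Nat.exists_eq_add_of_lt hpos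
    rw [hM, zero_add] at ih ⊢
    rw [Finset.sum_range_succ'] at ih ⊢
    rw [h0, add_zero] at ih
    have hrest : ∑ k ∈ Finset.range M, ∑ r ∈ Finset.range (b ^ 2),
        wt b α β (b ^ 2 * (k + 1) + r) ≤
        (∑ k ∈ Finset.range M, wt b α β (k + 1)) * (1 - 1 / (2 * (b:ℝ) ^ 2)) := by
      rw [Finset.sum_mul]
      exact Finset.sum_le_sum fun k _ => hinner (k + 1) (by omega)
    have hfac : (0:ℝ) ≤ 1 - 1 / (2 * (b:ℝ) ^ 2) := by
      rw [sub_nonneg, div_le_one (by positivity)]; nlinarith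
    have h3 := mul_le_mul_of_nonneg_right ih hfac
    have h4 : 2 * (b:ℝ) ^ 4 * (1 - 1 / (2 * (b:ℝ) ^ 2)) = 2 * (b:ℝ) ^ 4 - (b:ℝ) ^ 2 := by
      field_simp
    linarith

lemma wt_summable (b : ℕ) (hb : 2 ≤ b) (α β : ℕ) (hα : α < b) (hβ : β < b) :
    Summable (wt b α β) := by
  apply summable_of_sum_range_le (c := 2 * (b : ℝ) ^ 4) (wt_nonneg b α β)
  intro n
  refine le_trans ?_ (wt_sum_le b hb α β hα hβ n)
  apply Finset.sum_le_sum_of_subset_of_nonneg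
  · intro k hk
    rw [Finset.mem_range] at *
    exact hk.trans (Nat.lt_pow_self (by nlinarith))
  · intro i _ _; exact wt_nonneg b α β i

open Classical in
/-- the summand restricted to a predicate -/
noncomputable def res (P : ℕ → Prop) (m : ℕ) : ℝ := if P m then 1 / (m : ℝ) else 0

lemma res_tsum (P : ℕ → Prop) : ∑' m : {m : ℕ // P m}, (1 : ℝ) / (m : ℕ) = ∑' m, res P m := by
  have := tsum_subtype {m : ℕ | P m} (fun m : ℕ => (1:ℝ) / (m:ℝ))
  refine Eq.trans this ?_
  apply tsum_congr
  intro m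
  by_cases h : P m <;> simp [res, h, Set.indicator]

lemma res_summable (b : ℕ) (hb : 2 ≤ b) (α β : ℕ) (hα : α < b) (hβ : β < b)
    (P : ℕ → Prop) (K : ℕ) (hP : ∀ m, P m → pairCnt α β (digitsBE b m) ≤ K) :
    Summable (res P) := by
  refine Summable.of_nonneg_of_le (f := fun m => 2 ^ K * wt b α β m) ?_ ?_
    ((wt_summable b hb α β hα hβ).mul_left _)
  · intro m; unfold res; split_ifs <;> positivity
  · intro m
    unfold res
    split_ifs with h
    · have h1 : ((1:ℝ) / 2) ^ K ≤ (1 / 2) ^ (pairCnt α β (digitsBE b m)) :=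
        pow_le_pow_of_le_one (by norm_num) (by norm_num) (hP m h)
      unfold wt
      rw [← mul_assoc]
      have h2 : (1:ℝ) ≤ 2 ^ K * (1 / 2) ^ (pairCnt α β (digitsBE b m)) := by
        calc (1:ℝ) = 2 ^ K * (1 / 2) ^ K := by rw [← mul_pow]; norm_num
          _ ≤ _ := by gcongr
      exact le_mul_of_one_le_left (by positivity) h2
    · have := wt_nonneg b α β m
      positivity

lemma keptU_summable (b : ℕ) (hb : 2 ≤ b) (α β : ℕ) (hα : α < b) (hβ : β < b) (n : ℕ) :
    Summable (res (KeptU b α β n)) := by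
  apply res_summable b hb α β hα hβ _ ((digitsBE b n).length)
  rintro m ⟨t, ht, h⟩
  rw [infix_iff_pairCnt] at h
  have := pairCnt_append_le α β (digitsBE b n) t
  rw [ht]; omega

lemma keptV_summable (b : ℕ) (hb : 2 ≤ b) (α β : ℕ) (hα : α < b) (hβ : β < b) (n : ℕ) :
    Summable (res (KeptV b α β n)) := by
  apply res_summable b hb α β hα hβ _ ((digitsBE b n).length + 1)
  rintro m ⟨t, ht, h⟩
  have h : pairCnt α β t = 1 := h
  have := pairCnt_append_le α β (digitsBE b n) t
  rw [ht]; omega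

lemma keptV_two (b : ℕ) (hb : 2 ≤ b) (α β m n d e : ℕ) (t : List ℕ)
    (hD : digitsBE b m = d :: e :: t)
    (hn : b ≤ n) (hn2 : n < b ^ 2) (he : e < b) :
    KeptV b α β n m ↔ n = d * b + e ∧ pairCnt α β t = 1 := by
  have hx : n / b < b := Nat.div_lt_of_lt_mul (by rw [← pow_two]; exact hn2)
  have hy : n % b < b := Nat.mod_lt _ (by omega)
  have h2 := digitsBE_two b hb (n / b) (n % b) hx hy (Nat.div_pos hn (by omega))
  have hnn : n / b * b + n % b = n := Nat.div_add_mod' n b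
  rw [hnn] at h2
  unfold KeptV
  rw [hD, h2]
  constructor
  · rintro ⟨t', h, hc⟩
    simp only [List.cons_append, List.nil_append, List.cons.injEq] at h
    obtain ⟨rfl, rfl, rfl⟩ := h
    exact ⟨hnn.symm, hc⟩
  · rintro ⟨h, hc⟩
    refine ⟨t, ?_, hc⟩
    have h1 : n / b = d := by
      rw [h, mul_comm, Nat.mul_add_div (by omega), Nat.div_eq_of_lt he]; simp
    have h2 : n % b = e := by
      rw [h, mul_comm, Nat.mul_add_mod, Nat.mod_eq_of_lt he]
    rw [h1, h2]; rfl

lemma pairCnt_cons_ne (α β x : ℕ) (t : List ℕ) (h : x ≠ α) :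
    pairCnt α β (x :: t) = pairCnt α β t := by
  cases t with
  | nil => simp [pairCnt_nil, pairCnt_single]
  | cons y t => rw [pairCnt_cons_cons]; simp [h]

lemma kept_three (b : ℕ) (hb : 2 ≤ b) (α β m w d e : ℕ) (hα : α < b) (hβ : β < b) (hαβ : α ≠ β)
    (t : List ℕ) (hD : digitsBE b m = d :: e :: t) (hw : 0 < w) (hw2 : w < b) :
    (KeptV b α β (w * b ^ 2 + α * b + β) m ↔
      w = d ∧ (e = α ∧ t.head? = some β ∧ pairCnt α β t = 1)) ∧
    (KeptU b α β (w * b ^ 2 + α * b + β) m ↔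
      w = d ∧ (e = α ∧ t.head? = some β ∧ pairCnt α β t = 0)) := by
  have h3 := digitsBE_three b hb w α β hw2 hα hβ hw
  have hV : ∀ t, (t.zip t.tail).count (α, β) = pairCnt α β t := by
    intro t; rfl
  unfold KeptV KeptU
  rw [hD, h3]
  simp only [infix_iff_pairCnt, hV]
  cases t with
  | nil => simp
  | cons y t =>
    simp only [List.cons_append, List.nil_append, List.cons.injEq, List.head?_cons,
      Option.some.injEq]
    constructor
    · constructor
      · rintro ⟨t', ⟨rfl, rfl, rfl, rfl⟩, hc⟩
        exact ⟨rfl, rfl, rfl, by rw [pairCnt_cons_ne _ _ _ _ hαβ.symm, hc]⟩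
      · rintro ⟨rfl, rfl, rfl, hc⟩
        rw [pairCnt_cons_ne _ _ _ _ hαβ.symm] at hc
        exact ⟨t, ⟨rfl, rfl, rfl, rfl⟩, hc⟩
    · constructor
      · rintro ⟨t', ⟨rfl, rfl, rfl, rfl⟩, hc⟩
        exact ⟨rfl, rfl, rfl, by rw [pairCnt_cons_ne _ _ _ _ hαβ.symm, hc]⟩
      · rintro ⟨rfl, rfl, rfl, hc⟩
        rw [pairCnt_cons_ne _ _ _ _ hαβ.symm] at hc
        exact ⟨t, ⟨rfl, rfl, rfl, rfl⟩, hc⟩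

lemma keptU_two (b : ℕ) (hb : 2 ≤ b) (α β m d e : ℕ) (hα : α < b) (hβ : β < b) (h0 : α ≠ 0)
    (t : List ℕ) (hD : digitsBE b m = d :: e :: t) :
    KeptU b α β (α * b + β) m ↔ d = α ∧ e = β ∧ pairCnt α β t = 0 := by
  unfold KeptU
  rw [hD, digitsBE_two b hb α β hα hβ (Nat.pos_of_ne_zero h0)]
  simp only [infix_iff_pairCnt, List.cons_append, List.nil_append, List.cons.injEq]
  constructor
  · rintro ⟨t', ⟨rfl, rfl, rfl⟩, hc⟩
    exact ⟨rfl, rfl, hc⟩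
  · rintro ⟨rfl, rfl, hc⟩
    exact ⟨t, ⟨rfl, rfl, rfl⟩, hc⟩

lemma digitsBE_lt (b : ℕ) (hb : 2 ≤ b) (m x : ℕ) (h : x ∈ digitsBE b m) : x < b := by
  unfold digitsBE at h
  rw [List.mem_reverse] at h
  exact Nat.digits_lt_base (by omega) h

lemma digitsBE_head (b : ℕ) (m d : ℕ) (l : List ℕ) (h : digitsBE b m = d :: l) : 0 < d := by
  have hm : m ≠ 0 := by
    rintro rfl
    simp [digitsBE] at h
  have := Nat.getLast_digit_ne_zero b hm
  have h2 : Nat.digits b m = l.reverse ++ [d] := by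
    unfold digitsBE at h
    rw [← List.reverse_reverse (Nat.digits b m), h]; simp
  simp only [h2, List.getLast_append_singleton] at this
  omega

lemma kept_len (b α β n m : ℕ) (h : (digitsBE b m).length < (digitsBE b n).length) :
    ¬ KeptU b α β n m ∧ ¬ KeptV b α β n m := by
  constructor <;>
  · rintro ⟨t, ht, -⟩
    rw [ht, List.length_append] at h
    omega

open Classical in
lemma pointwise (b : ℕ) (hb : 2 ≤ b) (α β : ℕ) (hα : α < b) (hβ : β < b) (hαβ : α ≠ β) (m : ℕ) :
    res (fun m => 0 < m ∧ ((digitsBE b m).zip (digitsBE b m).tail).count (α, β) = 1) m =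
      (∑ n ∈ (Finset.Ico b (b ^ 2)).erase (α * b + β), res (KeptV b α β n) m)
      - (∑ n₁ ∈ Finset.Icc 1 (b - 1), res (KeptV b α β (n₁ * b ^ 2 + α * b + β)) m)
      + (if α ≠ 0 then res (KeptU b α β (α * b + β)) m else 0)
      + ∑ n₁ ∈ Finset.Icc 1 (b - 1), res (KeptU b α β (n₁ * b ^ 2 + α * b + β)) m := by
  have hV : ∀ t, (t.zip t.tail).count (α, β) = pairCnt α β t := by
    intro t; rfl
  by_cases hlen : (digitsBE b m).length < 2
  · have hL : ¬ (0 < m ∧ ((digitsBE b m).zip (digitsBE b m).tail).count (α, β) = 1) := by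
      rintro ⟨-, h⟩
      rw [hV] at h
      match hD : digitsBE b m, hlen with
      | [], _ => rw [hD, pairCnt_nil] at h; omega
      | [x], _ => rw [hD, pairCnt_single] at h; omega
    have h1 : ∀ n ∈ (Finset.Ico b (b ^ 2)).erase (α * b + β), res (KeptV b α β n) m = 0 := by
      intro n hn
      rw [Finset.mem_erase, Finset.mem_Ico] at hn
      have hx : n / b < b := Nat.div_lt_of_lt_mul (by rw [← pow_two]; exact hn.2.2)
      have h2 := digitsBE_two b hb (n / b) (n % b) hx (Nat.mod_lt _ (by omega))
        (Nat.div_pos hn.2.1 (by omega))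
      rw [Nat.div_add_mod' n b] at h2
      exact if_neg (kept_len b α β n m (by rw [h2]; exact hlen)).2
    have h2 : ∀ n ∈ Finset.Icc 1 (b - 1),
        res (KeptV b α β (n * b ^ 2 + α * b + β)) m = 0 ∧
        res (KeptU b α β (n * b ^ 2 + α * b + β)) m = 0 := by
      intro n hn
      rw [Finset.mem_Icc] at hn
      have h3 := digitsBE_three b hb n α β (by omega) hα hβ (by omega)
      have := kept_len b α β (n * b ^ 2 + α * b + β) m
        (by rw [h3]; simp only [List.length_cons, List.length_nil]; omega)
      exact ⟨if_neg this.2, if_neg this.1⟩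
    have h3 : (if α ≠ 0 then res (KeptU b α β (α * b + β)) m else 0) = 0 := by
      split_ifs with h
      · have h3 := digitsBE_two b hb α β hα hβ (Nat.pos_of_ne_zero h)
        exact if_neg (kept_len b α β _ m (by rw [h3]; exact hlen)).1
      · rfl
    rw [Finset.sum_eq_zero h1, Finset.sum_eq_zero (fun n hn => (h2 n hn).1),
      Finset.sum_eq_zero (fun n hn => (h2 n hn).2), h3]
    simp only [res, if_neg hL]
    norm_num
  · match hD : digitsBE b m, hlen with
    | [], h => simp at h
    | [x], h => simp at h
    | d :: e :: t, _ =>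
      have hd0 : 0 < d := digitsBE_head b m d _ hD
      have hd : d < b := digitsBE_lt b hb m d (by rw [hD]; simp)
      have he : e < b := digitsBE_lt b hb m e (by rw [hD]; simp)
      have hm : 0 < m := by
        rcases Nat.eq_zero_or_pos m with rfl | h
        · simp [digitsBE] at hD
        · exact h
      have hde : d * b + e ∈ Finset.Ico b (b ^ 2) := by
        rw [Finset.mem_Ico]; constructor <;> nlinarith
      have hinj : d * b + e = α * b + β ↔ d = α ∧ e = β := by
        constructor
        · intro h
          have h1 := congrArg (· / b) h
          have h2 := congrArg (· % b) h
          simp only [mul_comm _ b, Nat.mul_add_div (show 0 < b by omega), Nat.div_eq_of_lt he,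
            Nat.div_eq_of_lt hβ, add_zero, Nat.mul_add_mod, Nat.mod_eq_of_lt he,
            Nat.mod_eq_of_lt hβ] at h1 h2
          exact ⟨h1, h2⟩
        · rintro ⟨rfl, rfl⟩; rfl
      have S1 : (∑ n ∈ (Finset.Ico b (b ^ 2)).erase (α * b + β), res (KeptV b α β n) m) =
          if ¬ (d = α ∧ e = β) ∧ pairCnt α β t = 1 then 1 / (m:ℝ) else 0 := by
        have : ∀ n ∈ (Finset.Ico b (b ^ 2)).erase (α * b + β), res (KeptV b α β n) m =
            if n = d * b + e then (if pairCnt α β t = 1 then 1 / (m:ℝ) else 0) else 0 := by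
          intro n hn
          rw [Finset.mem_erase, Finset.mem_Ico] at hn
          simp only [res, keptV_two b hb α β m n d e t hD hn.2.1 hn.2.2 he, ite_and]
        rw [Finset.sum_congr rfl this, Finset.sum_ite_eq']
        simp only [Finset.mem_erase, hde, and_true, ne_eq, hinj, ite_and]
      have hdI : d ∈ Finset.Icc 1 (b - 1) := by rw [Finset.mem_Icc]; omega
      have S2 : (∑ n₁ ∈ Finset.Icc 1 (b - 1), res (KeptV b α β (n₁ * b ^ 2 + α * b + β)) m) =
          if e = α ∧ t.head? = some β ∧ pairCnt α β t = 1 then 1 / (m:ℝ) else 0 := by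
        have : ∀ n ∈ Finset.Icc 1 (b - 1), res (KeptV b α β (n * b ^ 2 + α * b + β)) m =
            if n = d then (if e = α ∧ t.head? = some β ∧ pairCnt α β t = 1
              then 1 / (m:ℝ) else 0) else 0 := by
          intro n hn
          rw [Finset.mem_Icc] at hn
          rw [← ite_and]
          unfold res
          exact if_congr (kept_three b hb α β m n d e hα hβ hαβ t hD (by omega) (by omega)).1
            rfl rfl
        rw [Finset.sum_congr rfl this, Finset.sum_ite_eq', if_pos hdI]
      have S3 : (∑ n₁ ∈ Finset.Icc 1 (b - 1), res (KeptU b α β (n₁ * b ^ 2 + α * b + β)) m) =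
          if e = α ∧ t.head? = some β ∧ pairCnt α β t = 0 then 1 / (m:ℝ) else 0 := by
        have : ∀ n ∈ Finset.Icc 1 (b - 1), res (KeptU b α β (n * b ^ 2 + α * b + β)) m =
            if n = d then (if e = α ∧ t.head? = some β ∧ pairCnt α β t = 0
              then 1 / (m:ℝ) else 0) else 0 := by
          intro n hn
          rw [Finset.mem_Icc] at hn
          rw [← ite_and]
          unfold res
          exact if_congr (kept_three b hb α β m n d e hα hβ hαβ t hD (by omega) (by omega)).2
            rfl rfl
        rw [Finset.sum_congr rfl this, Finset.sum_ite_eq', if_pos hdI]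
      have S4 : (if α ≠ 0 then res (KeptU b α β (α * b + β)) m else 0) =
          if d = α ∧ e = β ∧ pairCnt α β t = 0 then 1 / (m:ℝ) else 0 := by
        by_cases h : α = 0
        · have h2 : ¬ (d = α ∧ e = β ∧ pairCnt α β t = 0) := by
            rintro ⟨h', -⟩; omega
          rw [if_neg (by simpa using h), if_neg h2]
        · rw [if_pos h]
          unfold res
          exact if_congr (keptU_two b hb α β m d e hα hβ h t hD) rfl rfl
      have S0 : pairCnt α β (d :: e :: t) = pairCnt α β t
          + (if e = α ∧ t.head? = some β then 1 else 0) + (if d = α ∧ e = β then 1 else 0) := by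
        rw [pairCnt_cons_cons]
        cases t with
        | nil => simp [pairCnt_nil, pairCnt_single]
        | cons y t => rw [pairCnt_cons_cons]; simp
      rw [S1, S2, S3, S4]
      unfold res
      simp only [hV, hm, true_and]
      rw [hD, S0]
      generalize pairCnt α β t = c
      by_cases h1 : d = α ∧ e = β
      · have h2 : ¬ (e = α) := by rintro rfl; exact hαβ h1.2
        simp [h1.1, h1.2, hαβ.symm]
      · by_cases h2 : e = α
        · by_cases h3 : t.head? = some β
          · subst h2
            simp [h3, hαβ]
          · subst h2
            simp [h3, hαβ]
        · have h4 : ¬ (d = α ∧ e = β ∧ c = 0) := fun h => h1 ⟨h.1, h.2.1⟩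
          simp only [h1, h2, h4, false_and, if_false, not_false_eq_true, true_and]
          simp

theorem stmt_13 (b : ℕ) (hb : 2 ≤ b) (α β : ℕ) (hα : α < b) (hβ : β < b) (hαβ : α ≠ β) :
    K1 b α β = (∑ n ∈ (Finset.Ico b (b ^ 2)).erase (α * b + β), V b α β n)
      - (∑ n₁ ∈ Finset.Icc 1 (b - 1), V b α β (n₁ * b ^ 2 + α * b + β))
      + (if α ≠ 0 then U b α β (α * b + β) else 0)
      + ∑ n₁ ∈ Finset.Icc 1 (b - 1), U b α β (n₁ * b ^ 2 + α * b + β) := by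
  have hV := fun n => keptV_summable b hb α β hα hβ n
  have hU := fun n => keptU_summable b hb α β hα hβ n
  unfold K1 U V
  simp only [res_tsum]
  rw [tsum_congr (pointwise b hb α β hα hβ hαβ)]
  have s1 : Summable fun m => ∑ n ∈ (Finset.Ico b (b ^ 2)).erase (α * b + β),
      res (KeptV b α β n) m := summable_sum fun n _ => hV n
  have s2 : Summable fun m => ∑ n₁ ∈ Finset.Icc 1 (b - 1),
      res (KeptV b α β (n₁ * b ^ 2 + α * b + β)) m := summable_sum fun n _ => hV _
  have s3 : Summable fun m => ∑ n₁ ∈ Finset.Icc 1 (b - 1),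
      res (KeptU b α β (n₁ * b ^ 2 + α * b + β)) m := summable_sum fun n _ => hU _
  have s4 : Summable fun m => if α ≠ 0 then res (KeptU b α β (α * b + β)) m else 0 := by
    split_ifs
    · exact hU _
    · exact summable_zero
  have e4 : ∑' m, (if α ≠ 0 then res (KeptU b α β (α * b + β)) m else 0) =
      if α ≠ 0 then ∑' m, res (KeptU b α β (α * b + β)) m else 0 := by
    split_ifs
    · rfl
    · exact tsum_zero
  rw [((s1.sub s2).add s4).tsum_add s3, (s1.sub s2).tsum_add s4, s1.tsum_sub s2, e4,
    Summable.tsum_finsetSum fun n _ => hV n, Summable.tsum_finsetSum fun n _ => hV _,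
    Summable.tsum_finsetSum fun n _ => hU _]
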